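/- Let w ∈ W be in reduced form and satisfy Hypothesis (L). If w(i₀) = i₀' for some i₀ with 1 ≤ i₀ ≤ n, then w(i) = i' for all i with 1 ≤ i ≤ i₀. -/

import Mathlib

/-!  Common framework: Weyl groups of classical groups, modeled as permutations of ℕ
supported on `{1,…,r₀}`, with the convention `i' = r₀ + 1 - i`. -/

/-- `IsWfull r₀ w`: `w` fixes every point outside `{1,…,r₀}` and commutes with the
involution `ι : i ↦ r₀ + 1 - i` on `{1,…,r₀}`.  This is the full group of permutations
of `{1,…,r₀}` commuting with `ι` (the Weyl group of `SO(2r+1)`, `U(2r+1)` or `U(2r)`). -/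
def IsWfull (r₀ : ℕ) (w : Equiv.Perm ℕ) : Prop :=
  (∀ i : ℕ, ¬(1 ≤ i ∧ i ≤ r₀) → w i = i) ∧
  (∀ i : ℕ, 1 ≤ i → i ≤ r₀ → w (r₀ + 1 - i) = r₀ + 1 - w i)

/-- The parity condition singling out the Weyl group of `SO(2r)`:
the number of indices `1 ≤ i ≤ r` with `w i > r` is even. -/
def EvenCond (r : ℕ) (w : Equiv.Perm ℕ) : Prop :=
  Even (((Finset.Icc 1 r).filter (fun i => r < w i)).card)

/-- Membership in `W`; the proposition `so2r` indicates whether we are in the `SO(2r)`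
case (where the parity condition is imposed on top of `IsWfull`). -/
def MemW (r r₀ : ℕ) (so2r : Prop) (w : Equiv.Perm ℕ) : Prop :=
  IsWfull r₀ w ∧ (so2r → EvenCond r w)

/-- Membership in `W_M`: an element of `W` with `w({1,…,n}) = {1,…,n}` and
`w({n+1,…,r₀−n}) = {n+1,…,r₀−n}`. -/
def MemWM (r r₀ n : ℕ) (so2r : Prop) (m : Equiv.Perm ℕ) : Prop :=
  MemW r r₀ so2r m ∧
  (Finset.Icc 1 n).image (fun i => m i) = Finset.Icc 1 n ∧
  (Finset.Icc (n + 1) (r₀ - n)).image (fun i => m i) = Finset.Icc (n + 1) (r₀ - n)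

/-- The left coset `w·{m | P m}`. -/
def coset (P : Equiv.Perm ℕ → Prop) (w : Equiv.Perm ℕ) : Set (Equiv.Perm ℕ) :=
  {x | ∃ m, P m ∧ x = w * m}

/-- `w` is in standard form: a product of pairwise disjoint transpositions
`∏ᵢ (aᵢ aᵢ') · ∏ᵢ (bᵢ cᵢ)(cᵢ' bᵢ')` with `aᵢ, bᵢ ∈ {1,…,n}` and `cᵢ ∈ {n+1,…,r₀−n}`.
This is encoded pointwise: `w` belongs to the full group `W`, is an involution, every
moved point `i ∈ {1,…,n}` has `w i = i'` or `w i ∈ {n+1,…,r₀−n}`, and every moved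
point `i ∈ {n+1,…,r₀−n}` has `w i ∈ {1,…,n}` or `w i ∈ {n',…,r₀}`. -/
def IsStandardForm (r₀ n : ℕ) (w : Equiv.Perm ℕ) : Prop :=
  IsWfull r₀ w ∧ w * w = 1 ∧
  (∀ i, 1 ≤ i → i ≤ n → w i ≠ i →
    (w i = r₀ + 1 - i ∨ (n + 1 ≤ w i ∧ w i ≤ r₀ - n))) ∧
  (∀ i, n + 1 ≤ i → i ≤ r₀ - n → w i ≠ i →
    (w i ≤ n ∨ r₀ + 1 - n ≤ w i))

/-- The 4-cycle `(a b c d)` sending `a ↦ b ↦ c ↦ d ↦ a`. -/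
def cycle4 (a b c d : ℕ) : Equiv.Perm ℕ :=
  Equiv.swap a b * Equiv.swap b c * Equiv.swap c d

/-- `w` is in reduced form: `w = w₁ w₂` with `w₁` in standard form, `w₂` disjoint from
`w₁`, and `w₂` either the identity, or (only in the `SO(2r)` case) a transposition
`(d₀ d₀')` with `n+1 ≤ d₀ ≤ r`, or a 4-cycle `(i₀ j₀' i₀' j₀)` with `1 ≤ i₀ ≤ n < j₀ ≤ r`. -/
def IsReducedForm (r r₀ n : ℕ) (so2r : Prop) (w : Equiv.Perm ℕ) : Prop :=
  ∃ w₁ w₂ : Equiv.Perm ℕ,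
    IsStandardForm r₀ n w₁ ∧ w = w₁ * w₂ ∧ Equiv.Perm.Disjoint w₁ w₂ ∧
    (w₂ = 1 ∨
      (so2r ∧
        ((∃ d₀, n + 1 ≤ d₀ ∧ d₀ ≤ r ∧ w₂ = Equiv.swap d₀ (r₀ + 1 - d₀)) ∨
         (∃ i₀ j₀, 1 ≤ i₀ ∧ i₀ ≤ n ∧ n < j₀ ∧ j₀ ≤ r ∧
            w₂ = cycle4 i₀ (r₀ + 1 - j₀) (r₀ + 1 - i₀) j₀))))

/-- The vector `e_i : {1,…,r₀} → ℤ` with `e_i(i) = 1`, `e_i(i') = −1`, `0` elsewhere. -/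
def evec (r₀ i : ℕ) : ℕ → ℤ :=
  fun k => if k = i then 1 else if k = r₀ + 1 - i then -1 else 0

/-- The simple root `α_i = e_i − e_{i+1}`. -/
def rootAlpha (r₀ i : ℕ) : ℕ → ℤ := evec r₀ i - evec r₀ (i + 1)

/-- The root `β = e_ℓ + e_{ℓ+1}`. -/
def rootBeta (r₀ l : ℕ) : ℕ → ℤ := evec r₀ l + evec r₀ (l + 1)

/-- The action of `w` on root vectors: `(w·v)(k) = v(w⁻¹ k)`. -/
def pact (w : Equiv.Perm ℕ) (v : ℕ → ℤ) : ℕ → ℤ := fun k => v (w⁻¹ k)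

/-- The set `X = {α_1,…,α_ℓ, β}`. -/
def Xset (r₀ l : ℕ) : Set (ℕ → ℤ) :=
  {v | (∃ i, 1 ≤ i ∧ i ≤ l ∧ v = rootAlpha r₀ i) ∨ v = rootBeta r₀ l}

/-- The set of short and long roots `{e_i, 2e_i : 1 ≤ i ≤ n}` from which `S₀` is drawn. -/
def ShortLong (r₀ n : ℕ) : Set (ℕ → ℤ) :=
  {v | ∃ i, 1 ≤ i ∧ i ≤ n ∧ (v = evec r₀ i ∨ v = evec r₀ i + evec r₀ i)}

/-- `Σ_P^+ = {e_i ± e_j : 1 ≤ i ≤ n < j ≤ r} ∪ {e_i + e_j : 1 ≤ i < j ≤ n} ∪ S₀`. -/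
def SigmaP (r r₀ n : ℕ) (S₀ : Set (ℕ → ℤ)) : Set (ℕ → ℤ) :=
  {v | ∃ i j, 1 ≤ i ∧ i ≤ n ∧ n < j ∧ j ≤ r ∧
        (v = evec r₀ i - evec r₀ j ∨ v = evec r₀ i + evec r₀ j)} ∪
  {v | ∃ i j, 1 ≤ i ∧ i < j ∧ j ≤ n ∧ v = evec r₀ i + evec r₀ j} ∪ S₀

/-- Hypothesis (E): `w·α ∉ X` for every `α ∈ Σ_P^+`. -/
def HypE (r r₀ n l : ℕ) (S₀ : Set (ℕ → ℤ)) (w : Equiv.Perm ℕ) : Prop :=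
  ∀ α ∈ SigmaP r r₀ n S₀, pact w α ∉ Xset r₀ l

/-- Hypothesis (L): `α_ℓ = w·α` for some `α ∈ Σ_P^+`; no other element of `X` is of the
form `w·α` with `α ∈ Σ_P^+`; and `w⁻¹·α_ℓ` is not of the form `e_i + e_j` with
`1 ≤ i, j ≤ n`. -/
def HypL (r r₀ n l : ℕ) (S₀ : Set (ℕ → ℤ)) (w : Equiv.Perm ℕ) : Prop :=
  (∃ α ∈ SigmaP r r₀ n S₀, pact w α = rootAlpha r₀ l) ∧
  (∀ α ∈ SigmaP r r₀ n S₀, pact w α ∈ Xset r₀ l → pact w α = rootAlpha r₀ l) ∧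
  ¬ ∃ i j, 1 ≤ i ∧ i ≤ n ∧ 1 ≤ j ∧ j ≤ n ∧
      pact w⁻¹ (rootAlpha r₀ l) = evec r₀ i + evec r₀ j

/-- The permutation `(1 r₀)(2 r₀−1)⋯(n n')`. -/
def w0base (r₀ n : ℕ) : Equiv.Perm ℕ :=
  (((List.range n).map (fun i => Equiv.swap (i + 1) (r₀ - i))).prod)

theorem IsReducedForm.apply_of_le {r r₀ n : ℕ} {so2r : Prop} {w : Equiv.Perm ℕ}
    (hnr : n ≤ r) (hr₀ : 2 * r ≤ r₀) (h : IsReducedForm r r₀ n so2r w)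
    {j : ℕ} (h1 : 1 ≤ j) (hj : j ≤ n) :
    w j = j ∨ w j = r₀ + 1 - j ∨ (n + 1 ≤ w j ∧ w j ≤ r₀ - n) := by
  obtain ⟨w₁, w₂, ⟨-, -, hs, -⟩, rfl, hd, h2⟩ := h
  have of_fixed : w₂ j = j → (w₁ * w₂) j = j ∨ (w₁ * w₂) j = r₀ + 1 - j ∨
      (n + 1 ≤ (w₁ * w₂) j ∧ (w₁ * w₂) j ≤ r₀ - n) := by
    intro hf
    rw [Equiv.Perm.mul_apply, hf]
    by_cases hm : w₁ j = j
    · exact Or.inl hm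
    · exact Or.inr (hs j h1 hj hm)
  rcases h2 with rfl | ⟨-, ⟨d, hd1, hd2, rfl⟩ | ⟨i, k, hi1, hi2, hk1, hk2, rfl⟩⟩
  · exact of_fixed rfl
  · exact of_fixed (Equiv.swap_apply_of_ne_of_ne (by omega) (by omega))
  · by_cases hji : j = i
    · subst hji
      have hw : cycle4 j (r₀ + 1 - k) (r₀ + 1 - j) k j = r₀ + 1 - k := by
        simp only [cycle4, Equiv.Perm.mul_apply, Equiv.swap_apply_def]
        split_ifs <;> omega
      have hw' : cycle4 j (r₀ + 1 - k) (r₀ + 1 - j) k (r₀ + 1 - k) ≠ r₀ + 1 - k := by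
        simp only [cycle4, Equiv.Perm.mul_apply, Equiv.swap_apply_def]
        split_ifs <;> omega
      have hfix := (hd (r₀ + 1 - k)).resolve_right hw'
      rw [Equiv.Perm.mul_apply, hw, hfix]
      omega
    · apply of_fixed
      simp only [cycle4, Equiv.Perm.mul_apply, Equiv.swap_apply_def]
      split_ifs <;> omega

theorem IsWfull.apply_mem {r₀ : ℕ} {w : Equiv.Perm ℕ} (hw : IsWfull r₀ w) {a : ℕ} :
    (1 ≤ w a ∧ w a ≤ r₀) ↔ (1 ≤ a ∧ a ≤ r₀) := by
  constructor
  · intro h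
    by_contra hc
    exact hc (hw.1 a hc ▸ h)
  · intro h
    by_contra hc
    exact hc ((w.injective (hw.1 _ hc)).symm ▸ h)

theorem pact_evec {r₀ : ℕ} {w : Equiv.Perm ℕ} (hw : IsWfull r₀ w) {a : ℕ}
    (h1 : 1 ≤ a) (ha : a ≤ r₀) : pact w (evec r₀ a) = evec r₀ (w a) := by
  funext x
  simp only [pact, evec, Equiv.Perm.inv_eq_iff_eq, hw.2 a h1 ha]

theorem evec_reflect {r₀ a : ℕ} (h1 : 1 ≤ a) (ha : 2 * a < r₀ + 1) :
    evec r₀ (r₀ + 1 - a) = -evec r₀ a := by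
  funext x
  simp only [evec, Pi.neg_apply]
  split_ifs <;> omega

theorem rootAlpha_ne {r₀ m l : ℕ} (hml : m < l) (hl : 2 * l + 1 < r₀) :
    rootAlpha r₀ m ≠ rootAlpha r₀ l := by
  intro h
  have h := congrFun h m
  simp only [rootAlpha, evec, Pi.sub_apply] at h
  split_ifs at h <;> omega

theorem HypL.pact_ne_rootAlpha {r r₀ n l : ℕ} {S₀ : Set (ℕ → ℤ)} {w : Equiv.Perm ℕ}
    (hL : HypL r r₀ n l S₀ w) (hl : 2 * l + 1 < r₀) {α : ℕ → ℤ}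
    (hα : α ∈ SigmaP r r₀ n S₀) {m : ℕ} (h1 : 1 ≤ m) (hm : m < l) :
    pact w α ≠ rootAlpha r₀ m := fun h =>
  rootAlpha_ne hm hl (h.symm.trans (hL.2.1 α hα (Or.inl ⟨m, h1, hm.le, h⟩)))

theorem apply_eq_reflect_of_succ {r n l r₀ : ℕ} {so2r : Prop} {S₀ : Set (ℕ → ℤ)}
    {w : Equiv.Perm ℕ} (hnl : n ≤ l) (hlr : l + 1 ≤ r)
    (hr₀ : r₀ = 2 * r ∨ r₀ = 2 * r + 1) (hw : IsWfull r₀ w)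
    (hred : IsReducedForm r r₀ n so2r w) (hL : HypL r r₀ n l S₀ w)
    {m : ℕ} (h1 : 1 ≤ m) (hm : m + 1 ≤ n) (h : w (m + 1) = r₀ + 1 - (m + 1)) :
    w m = r₀ + 1 - m := by
  obtain ⟨k, hk⟩ := w.surjective m
  obtain ⟨hk1, hk2⟩ : 1 ≤ k ∧ k ≤ r₀ := hw.apply_mem.1 (by omega)
  have hk' : w (r₀ + 1 - k) = r₀ + 1 - m := by rw [hw.2 k hk1 hk2, hk]
  have hsucc : pact w (evec r₀ (m + 1)) = -evec r₀ (m + 1) := by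
    rw [pact_evec hw (by omega) (by omega), h, evec_reflect (by omega) (by omega)]
  have hek : pact w (evec r₀ k) = evec r₀ m := by rw [pact_evec hw hk1 hk2, hk]
  have hadd : pact w (evec r₀ (m + 1) + evec r₀ k) = rootAlpha r₀ m := by
    change pact w (evec r₀ (m + 1)) + pact w (evec r₀ k) = _
    rw [hsucc, hek, rootAlpha]
    abel
  have hnot : evec r₀ (m + 1) + evec r₀ k ∉ SigmaP r r₀ n S₀ := fun hα =>
    hL.pact_ne_rootAlpha (by omega) hα h1 (by omega) hadd
  by_cases hkn : k ≤ n
  · have hkm : k = m := by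
      have := hred.apply_of_le (by omega) (by omega) hk1 hkn
      omega
    subst hkm
    exact absurd (Or.inl (Or.inr ⟨k, k + 1, h1, by omega, hm, add_comm _ _⟩)) hnot
  by_cases hkn' : r₀ + 1 - k ≤ n
  · have := hred.apply_of_le (by omega) (by omega) (j := r₀ + 1 - k) (by omega) hkn'
    have hkm : r₀ + 1 - k = m := by omega
    rwa [hkm] at hk'
  exfalso
  apply hnot
  by_cases hkr : k ≤ r
  · exact Or.inl (Or.inl ⟨m + 1, k, by omega, hm, by omega, hkr, Or.inr rfl⟩)
  have hmid : k ≠ r₀ + 1 - k := by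
    intro he
    rw [← he] at hk'
    omega
  refine Or.inl (Or.inl ⟨m + 1, r₀ + 1 - k, by omega, hm, by omega, by omega, Or.inl ?_⟩)
  have := evec_reflect (r₀ := r₀) (a := r₀ + 1 - k) (by omega) (by omega)
  rw [show r₀ + 1 - (r₀ + 1 - k) = k by omega] at this
  rw [this, sub_eq_add_neg]


/-- if `w ∈ W` is in reduced form, satisfies Hypothesis (L), and
`w i₀ = i₀'` for some `1 ≤ i₀ ≤ n`, then `w i = i'` for all `1 ≤ i ≤ i₀`. -/
theorem stmt15 (r n ℓ r₀ : ℕ) (so2r : Prop)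
    (hn : 1 ≤ n) (hnl : n ≤ ℓ) (hlr : ℓ + 1 ≤ r)
    (hr₀ : r₀ = 2 * r ∨ r₀ = 2 * r + 1) (hso : so2r → r₀ = 2 * r)
    (S₀ : Set (ℕ → ℤ)) (hS₀ : S₀ ⊆ ShortLong r₀ n)
    (w : Equiv.Perm ℕ) (hw : MemW r r₀ so2r w)
    (hred : IsReducedForm r r₀ n so2r w)
    (hL : HypL r r₀ n ℓ S₀ w) :
    ∀ i₀, 1 ≤ i₀ → i₀ ≤ n → w i₀ = r₀ + 1 - i₀ →
      ∀ i, 1 ≤ i → i ≤ i₀ → w i = r₀ + 1 - i := by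
  intro i₀ _ hi₀n h i hi1 hi
  induction hi using Nat.decreasingInduction with
  | self => exact h
  | of_succ m hm ih =>
    exact apply_eq_reflect_of_succ hnl hlr hr₀ hw.1 hred hL hi1 (by omega) (ih (by omega))
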